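/- arXiv:1205.2498 — 2 statements merged into one kernel-verified Lean document; each statement's English description precedes it below -/
import Mathlib

section
/- For every finite group G, the intersection of all maximal supersoluble subgroups of G is contained in the intersection of all maximal subgroups of G among the subgroups satisfying the Sylow tower property. -/
/-- A finite group `X` is supersoluble: there is a chain of subgroups
`⊥ = c 0 ≤ c 1 ≤ ... ≤ c n = ⊤`, each normal in the whole group, with all successive
quotients cyclic. -/
def IsSupersoluble (X : Type*) [Group X] : Prop :=
  ∃ (n : ℕ) (c : ℕ → Subgroup X), c 0 = ⊥ ∧ c n = ⊤ ∧ (∀ i, c i ≤ c (i + 1)) ∧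
    ∀ i, ∃ hn : (c i).Normal,
      letI := hn.subgroupOf (c (i + 1))
      IsCyclic (↥(c (i + 1)) ⧸ (c i).subgroupOf (c (i + 1)))

/-- A finite group `X` satisfies the Sylow tower property: writing
`|X| = p_1^{a_1} ⋯ p_r^{a_r}` with `p_1 > p_2 > ... > p_r` the distinct primes dividing
`|X|`, for each `i` there is a normal subgroup of `X` of order `p_1^{a_1} ⋯ p_i^{a_i}`.
Equivalently, for every `p` there is a normal subgroup whose order is the product of the
full prime-power parts `q^{a_q}` of `|X|` over the primes `q ≥ p` dividing `|X|`. -/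
def HasSylowTower (X : Type*) [Group X] : Prop :=
  ∀ p : ℕ, ∃ N : Subgroup X, N.Normal ∧
    Nat.card N =
      ∏ q ∈ (Nat.card X).primeFactors.filter (fun q => p ≤ q),
        q ^ (Nat.card X).factorization q

/-- `U` is a maximal supersoluble subgroup of `G`. -/
def IsMaximalSupersoluble {G : Type*} [Group G] (U : Subgroup G) : Prop :=
  IsSupersoluble U ∧ ∀ V : Subgroup G, U ≤ V → IsSupersoluble V → U = V

/-- `U` is a maximal subgroup of `G` among subgroups with the Sylow tower property. -/
def IsMaximalSylowTower {G : Type*} [Group G] (U : Subgroup G) : Prop :=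
  HasSylowTower U ∧ ∀ V : Subgroup G, U ≤ V → HasSylowTower V → U = V

/-- Every prime divisor of `n` is at least `p`. -/
def PrimesGE (p n : ℕ) : Prop := ∀ q, q.Prime → q ∣ n → p ≤ q

/-- Every prime divisor of `n` is less than `p`. -/
def PrimesLT (p n : ℕ) : Prop := ∀ q, q.Prime → q ∣ n → q < p

section Arithmetic

variable {p m n : ℕ}

lemma PrimesGE.of_dvd (h : PrimesGE p n) (hmn : m ∣ n) : PrimesGE p m :=
  fun q hq hqm => h q hq (hqm.trans hmn)

lemma PrimesLT.of_dvd (h : PrimesLT p n) (hmn : m ∣ n) : PrimesLT p m :=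
  fun q hq hqm => h q hq (hqm.trans hmn)

lemma PrimesGE.mul (hm : PrimesGE p m) (hn : PrimesGE p n) : PrimesGE p (m * n) :=
  fun q hq hqm => (hq.dvd_mul.1 hqm).elim (hm q hq) (hn q hq)

lemma PrimesLT.mul (hm : PrimesLT p m) (hn : PrimesLT p n) : PrimesLT p (m * n) :=
  fun q hq hqm => (hq.dvd_mul.1 hqm).elim (hm q hq) (hn q hq)

lemma PrimesGE.one : PrimesGE p 1 := fun _ hq h => (hq.one_lt.ne' (Nat.dvd_one.1 h)).elim

lemma PrimesLT.one : PrimesLT p 1 := fun _ hq h => (hq.one_lt.ne' (Nat.dvd_one.1 h)).elim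

lemma PrimesGE.coprime (hm : PrimesGE p m) (hn : PrimesLT p n) : m.Coprime n :=
  Nat.coprime_of_dvd fun q hq hqm hqn => (hm q hq hqm).not_gt (hn q hq hqn)

lemma PrimesLT.totient (hn : PrimesLT p n) : PrimesLT p n.totient := by
  intro q hq hqn
  have h : q ∣ n * ∏ r ∈ n.primeFactors, (r - 1) := by
    rw [← Nat.totient_mul_prod_primeFactors]
    exact hqn.mul_right _
  rcases hq.dvd_mul.1 h with h | h
  · exact hn q hq h
  · obtain ⟨r, hr, hqr⟩ := (hq.prime.dvd_finsetProd_iff _).1 h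
    have hr' := Nat.prime_of_mem_primeFactors hr
    have h1 := Nat.le_of_dvd (by have := hr'.two_le; omega) hqr
    have h2 := hn r hr' (Nat.dvd_of_mem_primeFactors hr)
    omega

/-- The part of `n` composed of the primes that are at least `p`. -/
def roughPart (p n : ℕ) : ℕ :=
  ∏ q ∈ n.primeFactors.filter (fun q => p ≤ q), q ^ n.factorization q

lemma primesGE_roughPart (p n : ℕ) : PrimesGE p (roughPart p n) := by
  intro q hq h
  obtain ⟨r, hr, hqr⟩ := (hq.prime.dvd_finsetProd_iff _).1 h
  rw [Finset.mem_filter] at hr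
  have := (Nat.prime_dvd_prime_iff_eq hq (Nat.prime_of_mem_primeFactors hr.1)).1
    (hq.dvd_of_dvd_pow hqr)
  omega

lemma exists_roughPart_mul_eq (p : ℕ) (hn : n ≠ 0) : ∃ b, roughPart p n * b = n ∧ PrimesLT p b := by
  refine ⟨∏ q ∈ n.primeFactors.filter (fun q => ¬ p ≤ q), q ^ n.factorization q, ?_, ?_⟩
  · rw [roughPart, Finset.prod_filter_mul_prod_filter_not]
    exact Nat.prod_factorization_pow_eq_self hn
  · intro q hq h
    obtain ⟨r, hr, hqr⟩ := (hq.prime.dvd_finsetProd_iff _).1 h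
    rw [Finset.mem_filter] at hr
    have := (Nat.prime_dvd_prime_iff_eq hq (Nat.prime_of_mem_primeFactors hr.1)).1
      (hq.dvd_of_dvd_pow hqr)
    omega

lemma eq_roughPart_iff (hn : m * n ≠ 0) :
    m = roughPart p (m * n) ↔ PrimesGE p m ∧ PrimesLT p n := by
  obtain ⟨b, hb, hb'⟩ := exists_roughPart_mul_eq p hn
  constructor
  · intro h
    have hm := primesGE_roughPart p (m * n)
    rw [← h] at hm hb
    exact ⟨hm, Nat.eq_of_mul_eq_mul_left (Nat.pos_of_ne_zero (left_ne_zero_of_mul hn)) hb ▸ hb'⟩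
  · rintro ⟨h1, h2⟩
    apply Nat.dvd_antisymm
    · exact (h1.coprime hb').dvd_of_dvd_mul_right (hb.symm ▸ dvd_mul_right m n)
    · exact ((primesGE_roughPart p _).coprime h2).dvd_of_dvd_mul_right
        (dvd_of_mul_right_eq b hb)

end Arithmetic

/-- `N` is a normal Hall subgroup of `U` for the set of primes that are at least `p`. -/
structure IsNormalHall {G : Type*} [Group G] (p : ℕ) (N U : Subgroup G) : Prop where
  le : N ≤ U
  le_normalizer : U ≤ Subgroup.normalizer (N : Set G)
  primesGE_card : PrimesGE p (Nat.card N)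
  primesLT_relIndex : PrimesLT p (N.relIndex U)

section NormalHall

variable {G : Type*} [Group G] {p : ℕ}

lemma relIndex_sup_eq_of_le_normalizer {K H : Subgroup G}
    (h : H ≤ Subgroup.normalizer (K : Set G)) : K.relIndex (H ⊔ K) = K.relIndex H :=
  letI := Subgroup.normal_subgroupOf_of_le_normalizer h
  letI := Subgroup.normal_subgroupOf_sup_of_le_normalizer h
  Nat.card_congr (QuotientGroup.quotientInfEquivProdNormalizerQuotient H K h).toEquiv.symm

lemma IsNormalHall.primesGE_orderOf {N U : Subgroup G} (hN : IsNormalHall p N U) {x : G}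
    (hx : x ∈ N) : PrimesGE p (orderOf x) :=
  hN.primesGE_card.of_dvd (N.orderOf_dvd_natCard hx)

lemma IsNormalHall.mem {N U : Subgroup G} (hN : IsNormalHall p N U) {x : G}
    (hxU : x ∈ U) (hx : PrimesGE p (orderOf x)) : x ∈ N := by
  have := Subgroup.normal_subgroupOf_of_le_normalizer hN.le_normalizer
  have h1 : x ^ N.relIndex U ∈ N := (N.subgroupOf U).pow_index_mem ⟨x, hxU⟩
  obtain ⟨k, hk⟩ := exists_pow_eq_self_of_coprime (hx.coprime hN.primesLT_relIndex).symm
  rw [← hk]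
  exact N.pow_mem h1 k

lemma hasSylowTower_iff {X : Type*} [Group X] [Finite X] :
    HasSylowTower X ↔ ∀ p, ∃ N : Subgroup X, IsNormalHall p N ⊤ := by
  refine forall_congr' fun p => exists_congr fun N => ?_
  have h0 : Nat.card N * N.index ≠ 0 := by
    rw [N.card_mul_index]
    exact Nat.card_pos.ne'
  have h1 := eq_roughPart_iff (p := p) h0
  rw [N.card_mul_index, roughPart] at h1
  rw [h1]
  constructor
  · rintro ⟨hn, h2, h3⟩
    exact ⟨le_top, (Subgroup.normalizer_eq_top _).ge, h2, by rwa [N.relIndex_top_right]⟩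
  · rintro ⟨_, hn, h2, h3⟩
    rw [N.relIndex_top_right] at h3
    exact ⟨Subgroup.normalizer_eq_top_iff.1 (top_le_iff.1 hn), h2, h3⟩

lemma hasSylowTower_subgroup_iff [Finite G] {U : Subgroup G} :
    HasSylowTower U ↔ ∀ p, ∃ N : Subgroup G, IsNormalHall p N U := by
  rw [hasSylowTower_iff]
  refine forall_congr' fun p => ⟨?_, ?_⟩
  · rintro ⟨N, hN⟩
    have := Subgroup.normalizer_eq_top_iff.1 (top_le_iff.1 hN.le_normalizer)
    refine ⟨N.map U.subtype, U.map_subtype_le N, ?_, ?_, ?_⟩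
    · rw [Subgroup.le_normalizer_iff]
      rintro h hU _ ⟨k, hk, rfl⟩
      exact ⟨_, this.conj_mem k hk ⟨h, hU⟩, rfl⟩
    · rw [Subgroup.card_map_of_injective U.subtype_injective]
      exact hN.primesGE_card
    · have h := hN.primesLT_relIndex
      rwa [N.relIndex_top_right, ← Subgroup.comap_map_eq_self_of_injective U.subtype_injective N]
        at h
  · rintro ⟨N, hN⟩
    refine ⟨N.subgroupOf U, le_top, ?_, ?_, ?_⟩
    · have := Subgroup.normal_subgroupOf_of_le_normalizer hN.le_normalizer
      exact (Subgroup.normalizer_eq_top _).ge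
    · rw [Nat.card_congr (Subgroup.subgroupOfEquivOfLe hN.le).toEquiv]
      exact hN.primesGE_card
    · rw [Subgroup.relIndex_top_right]
      exact hN.primesLT_relIndex

/-- If every element of `G` lies in a subgroup containing the normal subgroup `I` and having a
normal Hall subgroup, then normal Hall subgroups of `H` yield normal Hall subgroups of `H ⊔ I`. -/
lemma IsNormalHall.exists_sup {I H M : Subgroup G} [I.Normal]
    (hI : ∀ g : G, ∃ U N : Subgroup G, I ≤ U ∧ g ∈ U ∧ IsNormalHall p N U)
    (hM : IsNormalHall p M H) : ∃ K, IsNormalHall p K (H ⊔ I) := by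
  obtain ⟨U₀, N₀, hIU₀, -, hN₀⟩ := hI 1
  obtain ⟨J, hJ⟩ : ∃ J, J = N₀ ⊓ I := ⟨_, rfl⟩
  have mem_J (x : G) : x ∈ J ↔ x ∈ I ∧ PrimesGE p (orderOf x) := by
    rw [hJ, Subgroup.mem_inf]
    exact ⟨fun h => ⟨h.2, hN₀.primesGE_orderOf h.1⟩, fun h => ⟨hN₀.mem (hIU₀ h.1) h.2, h.1⟩⟩
  have J_le : J ≤ I := hJ ▸ inf_le_right
  have hJn : J.Normal := by
    refine ⟨fun x hx g => ?_⟩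
    rw [mem_J] at hx ⊢
    refine ⟨Subgroup.Normal.conj_mem ‹_› x hx.1 g, ?_⟩
    rw [← MulAut.conj_apply, MulEquiv.orderOf_eq]
    exact hx.2
  have hJI : PrimesLT p (J.relIndex I) := by
    have := Subgroup.normal_subgroupOf_of_le_normalizer hN₀.le_normalizer
    rw [hJ, Subgroup.inf_relIndex_right]
    refine hN₀.primesLT_relIndex.of_dvd ?_
    rw [← Subgroup.relIndex_subgroupOf hIU₀]
    exact Subgroup.relIndex_dvd_index_of_normal _ _
  have hHK : H ≤ Subgroup.normalizer ((M ⊔ J : Subgroup G) : Set G) := by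
    rw [Subgroup.le_normalizer_iff]
    intro h hh k hk
    obtain ⟨m, hm, j, hj, rfl⟩ := Subgroup.mem_sup_of_normal_right.1 hk
    rw [← conj_mul]
    exact mul_mem (Subgroup.mem_sup_left (Subgroup.le_normalizer_iff.1 hM.le_normalizer h hh m hm))
      (Subgroup.mem_sup_right (hJn.conj_mem j hj h))
  have hIK : I ≤ Subgroup.normalizer ((M ⊔ J : Subgroup G) : Set G) := by
    rw [Subgroup.le_normalizer_iff]
    intro x hx k hk
    obtain ⟨m, hm, j, hj, rfl⟩ := Subgroup.mem_sup_of_normal_right.1 hk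
    have h1 : m⁻¹ * x * m * x⁻¹ ∈ J := by
      obtain ⟨U, N, hIU, hmU, hN⟩ := hI m
      have hmN := hN.mem hmU (hM.primesGE_orderOf hm)
      refine (mem_J _).2 ⟨?_, hN.primesGE_orderOf ?_⟩
      · have := Subgroup.Normal.conj_mem ‹I.Normal› x hx m⁻¹
        rw [inv_inv] at this
        exact mul_mem this (inv_mem hx)
      · have := mul_mem (inv_mem hmN)
          (Subgroup.le_normalizer_iff.1 hN.le_normalizer x (hIU hx) m hmN)
        simpa only [mul_assoc] using this
    have h2 : x * (m * j) * x⁻¹ = m * ((m⁻¹ * x * m * x⁻¹) * (x * j * x⁻¹)) := by group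
    rw [h2]
    exact mul_mem (Subgroup.mem_sup_left hm)
      (Subgroup.mem_sup_right (mul_mem h1 (hJn.conj_mem j hj x)))
  refine ⟨M ⊔ J, sup_le_sup hM.le J_le, sup_le hHK hIK, ?_, ?_⟩
  · rw [← Subgroup.relIndex_bot_left,
      ← Subgroup.relIndex_mul_relIndex ⊥ J (M ⊔ J) bot_le le_sup_right,
      Subgroup.relIndex_bot_left, Subgroup.relIndex_sup_right]
    exact ((hN₀.primesGE_card.of_dvd (Subgroup.card_dvd_of_le (hJ ▸ inf_le_left))).mul
      (hM.primesGE_card.of_dvd (Subgroup.relIndex_dvd_card _ _)))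
  · have h1 : I ⊔ (M ⊔ J) ≤ H ⊔ I :=
      sup_le le_sup_right (sup_le_sup hM.le J_le)
    have h2 : H ⊔ I = H ⊔ (I ⊔ (M ⊔ J)) :=
      le_antisymm (sup_le_sup_left le_sup_left _) (sup_le le_sup_left h1)
    have h3 : H ≤ Subgroup.normalizer ((I ⊔ (M ⊔ J) : Subgroup G) : Set G) := by
      have h4 : I ⊔ (M ⊔ J) = M ⊔ I :=
        le_antisymm (sup_le le_sup_right (sup_le_sup_left J_le _))
          (sup_le (le_sup_left.trans le_sup_right) le_sup_left)
      rw [h4]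
      exact hM.le_normalizer.trans (Subgroup.normalizer_le_normalizer_sup_of_normalizer_le_left
        Subgroup.le_normalizer_of_normal)
    rw [← Subgroup.relIndex_mul_relIndex _ _ _ le_sup_right h1,
      relIndex_sup_eq_of_le_normalizer hIK, h2, relIndex_sup_eq_of_le_normalizer h3]
    exact (hJI.of_dvd (Subgroup.relIndex_dvd_of_le_left _ le_sup_right)).mul
      (hM.primesLT_relIndex.of_dvd
        (Subgroup.relIndex_dvd_of_le_left _ (le_sup_left.trans le_sup_right)))

/-- Let `A ≤ N` be normal subgroups of `G` such that `A` is cyclic, all primes dividing `|N : A|`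
are at least `p` and all primes dividing `|G : N|` are less than `p`. Then `G` has a normal Hall
subgroup for the primes that are at least `p`. -/
lemma exists_isNormalHall_of_isCyclic [Finite G] {A N : Subgroup G} [A.Normal] [N.Normal]
    [IsCyclic A] (hAN : A ≤ N) (h : PrimesGE p (A.relIndex N)) (hN : PrimesLT p N.index) :
    ∃ K : Subgroup G, IsNormalHall p K ⊤ := by
  obtain ⟨b, hab, hb⟩ := exists_roughPart_mul_eq p (n := Nat.card A) Nat.card_pos.ne'
  have ha := primesGE_roughPart p (Nat.card A)
  generalize roughPart p (Nat.card A) = a at ha hab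
  obtain ⟨g, rfl⟩ := (Subgroup.isCyclic_iff_exists_zpowers_eq_top A).1 inferInstance
  rw [Nat.card_zpowers] at hab
  have ha0 : a ≠ 0 := left_ne_zero_of_mul (hab ▸ (orderOf_pos g).ne')
  obtain ⟨B, hB⟩ : ∃ B, B = Subgroup.zpowers (g ^ a) := ⟨_, rfl⟩
  have hBA : B ≤ Subgroup.zpowers g :=
    hB ▸ Subgroup.zpowers_le.2 (Subgroup.npow_mem_zpowers g a)
  have hBcard : Nat.card B = b := by
    rw [hB, Nat.card_zpowers, orderOf_pow_of_dvd ha0 (hab ▸ dvd_mul_right a b), ← hab,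
      Nat.mul_div_cancel_left _ (Nat.pos_of_ne_zero ha0)]
  have hBn : B.Normal := by
    refine ⟨?_⟩
    rw [hB]
    rintro _ ⟨k, rfl⟩ y
    obtain ⟨l, hl⟩ := Subgroup.Normal.conj_mem ‹(Subgroup.zpowers g).Normal› g
      (Subgroup.mem_zpowers g) y
    refine ⟨l * k, ?_⟩
    simp only at hl ⊢
    rw [← conj_zpow, ← conj_pow, ← hl, ← zpow_natCast, ← zpow_natCast, ← zpow_mul, ← zpow_mul,
      ← zpow_mul]
    congr 1
    ring
  have hBcyc : IsCyclic B := by rw [hB]; infer_instance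
  have hBN : PrimesGE p (B.relIndex N) := by
    rw [← Subgroup.relIndex_mul_relIndex _ _ _ hBA hAN]
    refine PrimesGE.mul ?_ h
    have h1 := Subgroup.relIndex_mul_relIndex ⊥ B (Subgroup.zpowers g) bot_le hBA
    rw [Subgroup.relIndex_bot_left, Subgroup.relIndex_bot_left, hBcard, Nat.card_zpowers, ← hab,
      mul_comm] at h1
    rwa [Nat.eq_of_mul_eq_mul_right
      (Nat.pos_of_ne_zero (right_ne_zero_of_mul (hab ▸ (orderOf_pos g).ne'))) h1]
  have hcomm : ∀ n ∈ N, ∀ x ∈ B, n * x * n⁻¹ = x := by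
    have h1 : PrimesLT p (Nat.card (N.map (MulAut.conjNormal (H := B)))) := by
      refine hb.totient.of_dvd ?_
      rw [← hBcard, ← IsCyclic.card_mulAut]
      exact Subgroup.card_subgroup_dvd_card _
    have h2 : PrimesGE p (Nat.card (N.map (MulAut.conjNormal (H := B)))) := by
      rw [← Subgroup.relIndex_ker]
      refine h.of_dvd (Subgroup.relIndex_dvd_of_le_left _ ?_)
      rintro _ ⟨k, rfl⟩
      ext ⟨x, hx⟩
      obtain ⟨l, rfl⟩ := hBA hx
      simp only [MulAut.conjNormal_apply, MulAut.one_apply]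
      group
    have h3 : N.map (MulAut.conjNormal (H := B)) = ⊥ := by
      rw [← Subgroup.card_eq_one]
      exact (Nat.coprime_self _).1 (h2.coprime h1)
    intro n hn x hx
    have h4 := (Subgroup.map_eq_bot_iff _).1 h3 hn
    have h5 := congrArg Subtype.val (DFunLike.congr_fun (MonoidHom.mem_ker.1 h4) ⟨x, hx⟩)
    simpa using h5
  have hBNle : B ≤ N := hBA.trans hAN
  have hBNcard : Nat.card (B.subgroupOf N) = b := by
    rw [Nat.card_congr (Subgroup.subgroupOfEquivOfLe hBNle).toEquiv, hBcard]
  obtain ⟨K, hK⟩ := Subgroup.exists_right_complement'_of_coprime (N := B.subgroupOf N)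
    (hBNcard ▸ (hBN.coprime hb).symm)
  have hKN : IsNormalHall p (K.map N.subtype) N := by
    refine ⟨N.map_subtype_le K, ?_, ?_, ?_⟩
    · have h1 : B.subgroupOf N ⊔ K ≤ Subgroup.normalizer (K : Set N) := by
        refine sup_le ?_ Subgroup.le_normalizer
        rw [Subgroup.le_normalizer_iff]
        intro x hx k hk
        have h2 : x * k * x⁻¹ = k := by
          have h3 := hcomm k k.2 x hx
          apply Subtype.ext
          push_cast
          rw [mul_inv_eq_iff_eq_mul] at h3 ⊢
          exact h3.symm
        rwa [h2]
      rw [hK.sup_eq_top, Subgroup.le_normalizer_iff] at h1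
      rw [Subgroup.le_normalizer_iff]
      rintro x hx _ ⟨k, hk, rfl⟩
      exact ⟨_, h1 ⟨x, hx⟩ trivial k hk, rfl⟩
    · rw [Subgroup.card_map_of_injective N.subtype_injective, ← hK.symm.index_eq_card]
      exact hBN
    · rw [Subgroup.relIndex, Subgroup.subgroupOf,
        Subgroup.comap_map_eq_self_of_injective N.subtype_injective, hK.index_eq_card,
        hBNcard]
      exact hb
  refine ⟨K.map N.subtype, le_top, ?_, hKN.primesGE_card, ?_⟩
  · rw [Subgroup.le_normalizer_iff]
    intro y _ x hx
    refine hKN.mem (Subgroup.Normal.conj_mem ‹N.Normal› x (hKN.le hx) y) ?_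
    rw [← MulAut.conj_apply, MulEquiv.orderOf_eq]
    exact hKN.primesGE_orderOf hx
  · rw [Subgroup.relIndex_top_right, ← Subgroup.relIndex_mul_index hKN.le]
    exact hKN.primesLT_relIndex.mul hN

end NormalHall

section Supersoluble

variable {X : Type*} [Group X]

lemma isCyclic_quotient_subgroupOf_iff {K L : Subgroup X} [(K.subgroupOf L).Normal] :
    IsCyclic (L ⧸ K.subgroupOf L) ↔ ∃ g ∈ L, ∀ x ∈ L, ∃ k : ℤ, (g ^ k)⁻¹ * x ∈ K := by
  constructor
  · rintro ⟨g, hg⟩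
    obtain ⟨g, rfl⟩ := QuotientGroup.mk_surjective g
    refine ⟨g, g.2, fun x hx => ?_⟩
    obtain ⟨k, hk⟩ := hg (QuotientGroup.mk ⟨x, hx⟩)
    have h := QuotientGroup.eq.1 ((QuotientGroup.mk_zpow (K.subgroupOf L) g k).trans hk)
    exact ⟨k, h⟩
  · rintro ⟨g, hg, h⟩
    refine ⟨QuotientGroup.mk ⟨g, hg⟩, fun x => ?_⟩
    obtain ⟨⟨x, hx⟩, rfl⟩ := QuotientGroup.mk_surjective x
    obtain ⟨k, hk⟩ := h x hx
    refine ⟨k, ?_⟩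
    simp only [← QuotientGroup.mk_zpow]
    exact QuotientGroup.eq.2 hk

lemma isSupersoluble_iff :
    IsSupersoluble X ↔ ∃ (n : ℕ) (c : ℕ → Subgroup X), c 0 = ⊥ ∧ c n = ⊤ ∧
      (∀ i, c i ≤ c (i + 1)) ∧ ∀ i, (c i).Normal ∧
        ∃ g ∈ c (i + 1), ∀ x ∈ c (i + 1), ∃ k : ℤ, (g ^ k)⁻¹ * x ∈ c i := by
  refine exists_congr fun n => exists_congr fun c => and_congr_right fun _ =>
    and_congr_right fun _ => and_congr_right fun _ => forall_congr' fun i => ?_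
  rw [← exists_prop]
  refine exists_congr fun hn => ?_
  have := hn.subgroupOf (c (i + 1))
  exact isCyclic_quotient_subgroupOf_iff

lemma isSupersoluble_of_isCyclic [IsCyclic X] : IsSupersoluble X := by
  obtain ⟨g, hg⟩ := IsCyclic.exists_generator (α := X)
  refine isSupersoluble_iff.2 ⟨1, fun i => if i = 0 then ⊥ else ⊤, rfl, rfl, ?_, ?_⟩
  · intro i
    simp
  · rintro (_ | i)
    · refine ⟨Subgroup.normal_bot, g, trivial, fun x _ => ?_⟩
      obtain ⟨k, rfl⟩ := hg x
      exact ⟨k, inv_mul_cancel _⟩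
    · exact ⟨Subgroup.normal_top, 1, trivial, fun x _ => ⟨0, trivial⟩⟩

lemma IsSupersoluble.of_mulEquiv {Y : Type*} [Group Y] (e : X ≃* Y) (h : IsSupersoluble X) :
    IsSupersoluble Y := by
  rw [isSupersoluble_iff] at h ⊢
  obtain ⟨n, c, h0, hn, hle, hc⟩ := h
  refine ⟨n, fun i => (c i).map e.toMonoidHom, ?_, ?_, fun i => Subgroup.map_mono (hle i), ?_⟩
  · simp only [h0, Subgroup.map_bot]
  · simp only [hn]
    exact Subgroup.map_top_of_surjective _ e.surjective
  · intro i
    obtain ⟨hnorm, g, hg, hx⟩ := hc i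
    refine ⟨hnorm.map _ e.surjective, e g, ⟨g, hg, rfl⟩, ?_⟩
    rintro _ ⟨x, hxc, rfl⟩
    obtain ⟨k, hk⟩ := hx x hxc
    exact ⟨k, _, hk, by simp⟩

lemma IsSupersoluble.hasSylowTower [Finite X] (h : IsSupersoluble X) : HasSylowTower X := by
  rw [hasSylowTower_iff]
  intro p
  obtain ⟨n, c, h0, hn, hle, hc⟩ := isSupersoluble_iff.1 h
  have key : ∀ i ≤ n, ∃ M : Subgroup X, M.Normal ∧ c i ≤ M ∧ PrimesGE p ((c i).relIndex M) ∧
      PrimesLT p M.index := by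
    intro i hi
    induction hi using Nat.decreasingInduction with
    | self =>
      rw [hn]
      refine ⟨⊤, Subgroup.normal_top, le_rfl, ?_, ?_⟩
      · rw [Subgroup.relIndex_self]
        exact PrimesGE.one
      · rw [Subgroup.index_top]
        exact PrimesLT.one
    | of_succ i _ ih =>
      obtain ⟨M, hM, hcM, hGE, hLT⟩ := ih
      obtain ⟨hnorm, g, hg, hgen⟩ := hc i
      have hnorm' := (hc (i + 1)).1
      have hsurj := QuotientGroup.mk'_surjective (c i)
      have := hM.map _ hsurj
      have := hnorm'.map _ hsurj
      have hcyc : IsCyclic ((c (i + 1)).map (QuotientGroup.mk' (c i))) := by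
        refine (Subgroup.isCyclic_iff_exists_zpowers_eq_top _).2 ⟨QuotientGroup.mk' (c i) g, ?_⟩
        apply le_antisymm
        · exact Subgroup.zpowers_le.2 ⟨g, hg, rfl⟩
        · rintro _ ⟨x, hx, rfl⟩
          obtain ⟨k, hk⟩ := hgen x hx
          refine ⟨k, ?_⟩
          simp only [← map_zpow]
          exact QuotientGroup.eq.2 hk
      have hcomap {L : Subgroup X} (hL : c i ≤ L) :
          (L.map (QuotientGroup.mk' (c i))).comap (QuotientGroup.mk' (c i)) = L :=
        Subgroup.comap_map_eq_self (by rwa [QuotientGroup.ker_mk'])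
      obtain ⟨K, hK⟩ := exists_isNormalHall_of_isCyclic (p := p)
        (A := (c (i + 1)).map (QuotientGroup.mk' (c i))) (N := M.map (QuotientGroup.mk' (c i)))
        (Subgroup.map_mono hcM)
        (by rwa [← Subgroup.relIndex_comap, hcomap (hle i)])
        (by rwa [← Subgroup.index_comap_of_surjective _ hsurj, hcomap ((hle i).trans hcM)])
      have hcK : c i ≤ K.comap (QuotientGroup.mk' (c i)) := by
        conv_lhs => rw [← QuotientGroup.ker_mk' (c i)]
        exact Subgroup.ker_le_comap _ _
      refine ⟨K.comap (QuotientGroup.mk' (c i)), ?_, hcK, ?_, ?_⟩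
      · have := Subgroup.normalizer_eq_top_iff.1 (top_le_iff.1 hK.le_normalizer)
        exact this.comap _
      · have h1 := Subgroup.relIndex_ker (K := K.comap (QuotientGroup.mk' (c i)))
          (QuotientGroup.mk' (c i))
        rw [QuotientGroup.ker_mk', Subgroup.map_comap_eq_self_of_surjective hsurj] at h1
        rw [h1]
        exact hK.primesGE_card
      · rw [Subgroup.index_comap_of_surjective _ hsurj, ← Subgroup.relIndex_top_right]
        exact hK.primesLT_relIndex
  obtain ⟨M, hM, -, hGE, hLT⟩ := key 0 n.zero_le
  rw [h0, Subgroup.relIndex_bot_left] at hGE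
  exact ⟨M, le_top, (Subgroup.normalizer_eq_top _).ge, hGE, by rwa [M.relIndex_top_right]⟩

end Supersoluble

section Maximal

variable {G : Type*} [Group G]

lemma IsSupersoluble.map_mulEquiv (e : G ≃* G) {U : Subgroup G} (h : IsSupersoluble U) :
    IsSupersoluble (U.map e.toMonoidHom) :=
  h.of_mulEquiv (e.subgroupMap U)

lemma IsMaximalSupersoluble.map_mulEquiv (e : G ≃* G) {U : Subgroup G}
    (h : IsMaximalSupersoluble U) : IsMaximalSupersoluble (U.map e.toMonoidHom) := by
  refine ⟨h.1.map_mulEquiv e, fun V hUV hV => ?_⟩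
  have hVe : IsSupersoluble (V.comap e.toMonoidHom) := by
    rw [Subgroup.comap_equiv_eq_map_symm']
    exact hV.map_mulEquiv e.symm
  have h1 := h.2 _ (Subgroup.map_le_iff_le_comap.1 hUV) hVe
  rw [h1]
  exact Subgroup.map_comap_eq_self_of_surjective e.surjective V

lemma exists_isMaximalSupersoluble_mem [Finite G] (g : G) :
    ∃ U : Subgroup G, IsMaximalSupersoluble U ∧ g ∈ U := by
  obtain ⟨U, hgU, hU⟩ := (Set.toFinite {V : Subgroup G | IsSupersoluble V}).exists_le_maximal
    (a := Subgroup.zpowers g) isSupersoluble_of_isCyclic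
  exact ⟨U, ⟨hU.1, fun V hUV hV => le_antisymm hUV (hU.2 hV hUV)⟩, Subgroup.zpowers_le.1 hgU⟩

variable (G) in
lemma normal_iInf_isMaximalSupersoluble :
    (⨅ U ∈ {U : Subgroup G | IsMaximalSupersoluble U}, U).Normal := by
  refine ⟨fun x hx g => ?_⟩
  simp only [Subgroup.mem_iInf] at hx ⊢
  intro U hU
  obtain ⟨u, hu, rfl⟩ := hx _ (IsMaximalSupersoluble.map_mulEquiv (MulAut.conj g⁻¹) hU)
  simpa [mul_assoc] using hu

end Maximal

/-- For every finite group `G`, the intersection of all maximal supersoluble subgroups of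
`G` is contained in the intersection of all maximal subgroups of `G` among the subgroups
satisfying the Sylow tower property. -/
theorem intersection_maximal_supersoluble_le_intersection_maximal_sylowTower
    (G : Type*) [Group G] [Finite G] :
    (⨅ U ∈ {U : Subgroup G | IsMaximalSupersoluble U}, U) ≤
      ⨅ U ∈ {U : Subgroup G | IsMaximalSylowTower U}, U := by
  have hI := normal_iInf_isMaximalSupersoluble G
  refine le_iInf₂ fun H hH => ?_
  rw [hH.2 (H ⊔ ⨅ U ∈ {U : Subgroup G | IsMaximalSupersoluble U}, U) le_sup_left ?_]
  · exact le_sup_right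
  rw [hasSylowTower_subgroup_iff]
  intro p
  obtain ⟨M, hM⟩ := hasSylowTower_subgroup_iff.1 hH.1 p
  refine hM.exists_sup fun g => ?_
  obtain ⟨U, hU, hg⟩ := exists_isMaximalSupersoluble_mem g
  obtain ⟨N, hN⟩ := hasSylowTower_subgroup_iff.1 hU.1.hasSylowTower p
  exact ⟨U, N, iInf₂_le U hU, hg, hN⟩
end

section
/- Let G be a finite group. Then the intersection of all maximal subgroups U of G among subgroups with nilpotent derived subgroup such that U is not subnormal in G equals the intersection of all maximal subgroups of G among subgroups with nilpotent derived subgroup. (Here an intersection over the empty family is understood to be G.) -/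
/-- A finite group `X` has nilpotent derived subgroup if its commutator subgroup is
nilpotent. -/
def HasNilpotentDerivedSubgroup (X : Type*) [Group X] : Prop :=
  Group.IsNilpotent ↥(commutator X)

/-- `U` is maximal among subgroups of `G` with nilpotent derived subgroup. -/
def IsMaximalNilpotentDerived {G : Type*} [Group G] (U : Subgroup G) : Prop :=
  HasNilpotentDerivedSubgroup U ∧
    ∀ V : Subgroup G, U ≤ V → HasNilpotentDerivedSubgroup V → U = V

/-- `H` is subnormal in `G`: there is a chain `H = H_0 ⊴ H_1 ⊴ ... ⊴ H_t = G`
with each term normal in the next. -/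
def IsSubnormalIn {G : Type*} [Group G] (H : Subgroup G) : Prop :=
  ∃ (t : ℕ) (c : ℕ → Subgroup G), c 0 = H ∧ c t = ⊤ ∧
    ∀ i < t, c i ≤ c (i + 1) ∧ ∀ g ∈ c (i + 1), ∀ n ∈ c i, g * n * g⁻¹ ∈ c i

universe u

theorem isSubnormal_of_isSubnormalIn {G : Type*} [Group G] {H : Subgroup G}
    (h : IsSubnormalIn H) : H.IsSubnormal := by
  obtain ⟨t, c, h0, ht, hc⟩ := h
  have key : ∀ j ≤ t, (c (t - j)).IsSubnormal := by
    intro j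
    induction j with
    | zero => intro _; simp [ht]
    | succ j ih =>
      intro hj
      obtain ⟨hle, hnorm⟩ := hc (t - (j + 1)) (by omega)
      have he : t - (j + 1) + 1 = t - j := by omega
      rw [he] at hle hnorm
      exact .step _ _ hle (ih (by omega)) ⟨fun n hn g => hnorm g g.2 n hn⟩
  simpa [h0] using key t le_rfl

theorem isSubnormalIn_of_isSubnormal {G : Type*} [Group G] {H : Subgroup G}
    (h : H.IsSubnormal) : IsSubnormalIn H := by
  obtain ⟨n, f, hf, hnorm, h0, hn⟩ := h.exists_chain
  refine ⟨n, f, h0, hn, fun i _ => ⟨hf (Nat.le_succ i), fun g hg x hx => ?_⟩⟩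
  exact (hnorm i).conj_mem ⟨x, hf (Nat.le_succ i) hx⟩ hx ⟨g, hg⟩

theorem isSubnormalIn_iff {G : Type*} [Group G] {H : Subgroup G} :
    IsSubnormalIn H ↔ H.IsSubnormal :=
  ⟨isSubnormal_of_isSubnormalIn, isSubnormalIn_of_isSubnormal⟩

/-- A finite group has a nilpotent subgroup supplementing its commutator subgroup. -/
theorem exists_isNilpotent_sup_commutator_eq_top (G : Type*) [Group G] [Finite G] :
    ∃ A : Subgroup G, Group.IsNilpotent A ∧ A ⊔ commutator G = ⊤ := by
  obtain ⟨A, hA, hmin⟩ := (wellFounded_lt (α := Subgroup G)).has_min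
    {A | A ⊔ commutator G = ⊤} ⟨⊤, by simp⟩
  refine ⟨A, ?_, hA⟩
  refine (Group.isNilpotent_of_finite_tfae (G := A)).out 0 2 |>.mpr fun M hM => ?_
  refine Subgroup.Normal.of_commutator_le _ ?_
  by_contra hle
  have hsup : M ⊔ commutator A = ⊤ := hM.2 _ (left_lt_sup.mpr hle)
  have hmap := congrArg (Subgroup.map A.subtype) hsup
  rw [Subgroup.map_sup, Subgroup.map_subtype_commutator, ← MonoidHom.range_eq_map,
    A.range_subtype] at hmap
  refine hmin (M.map A.subtype) ?_ ?_
  · refine top_unique ((show A ⊔ commutator G = ⊤ from hA).ge.trans (sup_le ?_ le_sup_right))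
    refine hmap.ge.trans (sup_le le_sup_left ?_)
    exact (Subgroup.commutator_mono le_top le_top).trans le_sup_right
  · refine lt_of_le_of_ne (Subgroup.map_subtype_le M) fun h => hM.1 ?_
    rwa [← Subgroup.map_subtype_inj, ← MonoidHom.range_eq_map, A.range_subtype]

/-- In a solvable group, no proper subnormal subgroup supplements the commutator subgroup. -/
theorem Subgroup.IsSubnormal.eq_top_of_sup_commutator {G : Type*} [Group G]
    [Group.IsSolvable G] {H : Subgroup G} (hH : H.IsSubnormal)
    (h : H ⊔ _root_.commutator G = ⊤) : H = ⊤ := by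
  rcases hH.lt_normal with hH | ⟨N, hN, hle, hlt⟩
  · exact hH
  · exfalso
    have htop : N ⊔ _root_.commutator G = ⊤ := top_unique (h ▸ sup_le_sup_right hle _)
    have : Nontrivial (G ⧸ N) := by
      rw [← not_subsingleton_iff_nontrivial, QuotientGroup.subsingleton_iff]
      exact hlt.ne
    have hmap := congrArg (Subgroup.map (QuotientGroup.mk' N)) htop
    rw [Subgroup.map_sup, QuotientGroup.map_mk'_self, bot_sup_eq, map_commutator_eq,
      Subgroup.map_top_of_surjective _ (QuotientGroup.mk'_surjective N),
      MonoidHom.range_eq_top.mpr (QuotientGroup.mk'_surjective N)] at hmap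
    exact (Group.IsSolvable.commutator_lt_top_of_nontrivial (G ⧸ N)).ne hmap

/-- A nilpotent normal subgroup of a finite group centralizes some nontrivial normal
subgroup inside any given nontrivial normal subgroup. -/
theorem exists_normal_le_commutator_eq_bot {G : Type*} [Group G] [Finite G]
    (H : Subgroup G) [H.Normal] (hH : Group.IsNilpotent H) (N : Subgroup G) [hN : N.Normal]
    (hne : N ≠ ⊥) : ∃ L : Subgroup G, L.Normal ∧ L ≠ ⊥ ∧ L ≤ N ∧ ⁅L, H⁆ = ⊥ := by
  obtain ⟨L, ⟨hL, hL0, hLN⟩, hmin⟩ := (wellFounded_lt (α := Subgroup G)).has_min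
    {L | L.Normal ∧ L ≠ ⊥ ∧ L ≤ N} ⟨N, hN, hne, le_rfl⟩
  refine ⟨L, hL, hL0, hLN, ?_⟩
  by_contra hcomm
  have hle : ⁅L, H⁆ ≤ L := Subgroup.commutator_le_left L H
  have heq : ⁅L, H⁆ = L := by
    by_contra hne'
    exact hmin _ ⟨inferInstance, hcomm, hle.trans hLN⟩ (lt_of_le_of_ne hle hne')
  have hlcs : ∀ n, L ≤ H.lowerCentralSeries n := by
    intro n
    induction n with
    | zero => exact heq.symm.le.trans (Subgroup.commutator_le_right L H)
    | succ n ih =>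
      rw [Subgroup.lowerCentralSeries_succ]
      exact heq.symm.le.trans (Subgroup.commutator_mono ih le_rfl)
  obtain ⟨n, hn⟩ := (Subgroup.isNilpotent_iff_lowerCentralSeries H).mp hH
  exact hL0 (le_bot_iff.mp (hn ▸ hlcs n))

/-- The Fitting theorem for finite groups. -/
theorem isNilpotent_of_normal_sup_eq_top {G : Type*} [Group G] [Finite G]
    (H K : Subgroup G) [H.Normal] [K.Normal] (hH : Group.IsNilpotent H)
    (hK : Group.IsNilpotent K) (h : H ⊔ K = ⊤) : Group.IsNilpotent G := by
  induction hn : Nat.card G using Nat.strong_induction_on generalizing G with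
  | _ n ih =>
  rcases subsingleton_or_nontrivial G with _ | _
  · exact Group.isNilpotent_of_subsingleton
  obtain ⟨L, _, hL0, -, hLH⟩ := exists_normal_le_commutator_eq_bot H hH ⊤ top_ne_bot
  obtain ⟨M, _, hM0, hML, hMK⟩ := exists_normal_le_commutator_eq_bot K hK L hL0
  have hMH : ⁅M, H⁆ = ⊥ := le_bot_iff.mp (hLH ▸ Subgroup.commutator_mono hML le_rfl)
  have hcenter : M ≤ Subgroup.center G := by
    have hle : H ⊔ K ≤ Subgroup.centralizer (M : Set G) := by
      rw [sup_le_iff, ← Subgroup.commutator_eq_bot_iff_le_centralizer,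
        ← Subgroup.commutator_eq_bot_iff_le_centralizer, Subgroup.commutator_comm,
        Subgroup.commutator_comm K]
      exact ⟨hMH, hMK⟩
    rw [h, ← Subgroup.commutator_eq_bot_iff_le_centralizer, Subgroup.commutator_comm] at hle
    exact Subgroup.commutator_top_right_eq_bot_iff_le_center.mp hle
  refine Group.of_quotient_center_nilpotent ?_
  have hsurj := QuotientGroup.mk'_surjective (Subgroup.center G)
  have : (H.map (QuotientGroup.mk' (Subgroup.center G))).Normal := .map ‹_› _ hsurj
  have : (K.map (QuotientGroup.mk' (Subgroup.center G))).Normal := .map ‹_› _ hsurj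
  refine ih _ ?_ (H.map (QuotientGroup.mk' (Subgroup.center G)))
    (K.map (QuotientGroup.mk' (Subgroup.center G)))
    (Group.nilpotent_of_surjective _ (MonoidHom.subgroupMap_surjective _ H))
    (Group.nilpotent_of_surjective _ (MonoidHom.subgroupMap_surjective _ K)) ?_ rfl
  · have hc : Subgroup.center G ≠ ⊥ := fun hc => hM0 (le_bot_iff.mp (hc ▸ hcenter))
    have h1 := (Subgroup.center G).card_eq_card_quotient_mul_card_subgroup
    have h2 := (Subgroup.one_lt_card_iff_ne_bot _).mpr hc
    have h3 : 0 < Nat.card (G ⧸ Subgroup.center G) := Nat.card_pos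
    nlinarith
  · rw [← Subgroup.map_sup, h, Subgroup.map_top_of_surjective _ hsurj]

theorem isSolvable_of_normal_sup_eq_top {G : Type*} [Group G] (H K : Subgroup G) [H.Normal]
    (hH : Group.IsSolvable H) (hK : Group.IsSolvable K) (h : H ⊔ K = ⊤) :
    Group.IsSolvable G := by
  refine (Group.isSolvable_iff_subgroup_quotient H).mpr ⟨hH, ?_⟩
  refine Group.isSolvable_of_surjective (f := (QuotientGroup.mk' H).comp K.subtype) ?_
  rw [← MonoidHom.range_eq_top, MonoidHom.range_comp, K.range_subtype]
  have hmap := congrArg (Subgroup.map (QuotientGroup.mk' H)) h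
  rwa [Subgroup.map_sup, QuotientGroup.map_mk'_self, bot_sup_eq,
    Subgroup.map_top_of_surjective _ (QuotientGroup.mk'_surjective H)] at hmap

/-- If a class of finite groups is closed under isomorphisms and under products of two normal
subgroups, then the subgroups in the class normalized by `L` and contained in `L` have a
greatest element. -/
theorem exists_isGreatest_normalized (Q : ∀ (X : Type u) [Group X], Prop)
    (hiso : ∀ (X Y : Type u) [Group X] [Group Y], X ≃* Y → Q X → Q Y)
    (hbot : ∀ (X : Type u) [Group X] [Subsingleton X], Q X)
    (hsup : ∀ (X : Type u) [Group X] [Finite X] (H K : Subgroup X) [H.Normal] [K.Normal],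
      Q H → Q K → H ⊔ K = ⊤ → Q X)
    {G : Type u} [Group G] [Finite G] (L : Subgroup G) :
    ∃ R, IsGreatest {N : Subgroup G | N ≤ L ∧ L ≤ Subgroup.normalizer N ∧ Q N} R := by
  obtain ⟨R, ⟨hRL, hRn, hRQ⟩, hmax⟩ := (wellFounded_gt (α := Subgroup G)).has_min
    {N : Subgroup G | N ≤ L ∧ L ≤ Subgroup.normalizer N ∧ Q N}
    ⟨⊥, bot_le, le_top.trans
      (Subgroup.normalizer_eq_top (H := (⊥ : Subgroup G))).ge, hbot _⟩
  refine ⟨R, ⟨hRL, hRn, hRQ⟩, fun N ⟨hNL, hNn, hNQ⟩ => ?_⟩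
  by_contra hle
  refine hmax (R ⊔ N) ⟨sup_le hRL hNL, ?_, ?_⟩ (left_lt_sup.mpr hle)
  · intro g hg
    rw [Subgroup.mem_normalizer_iff_map_conj_eq, Subgroup.map_sup,
      Subgroup.mem_normalizer_iff_map_conj_eq.mp (hRn hg),
      Subgroup.mem_normalizer_iff_map_conj_eq.mp (hNn hg)]
  · have : (R.subgroupOf (R ⊔ N)).Normal :=
      (Subgroup.normal_subgroupOf_iff_le_normalizer le_sup_left).mpr
        ((sup_le hRL hNL).trans hRn)
    have : (N.subgroupOf (R ⊔ N)).Normal :=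
      (Subgroup.normal_subgroupOf_iff_le_normalizer le_sup_right).mpr
        ((sup_le hRL hNL).trans hNn)
    refine hsup _ (R.subgroupOf (R ⊔ N)) (N.subgroupOf (R ⊔ N))
      (hiso _ _ (Subgroup.subgroupOfEquivOfLe le_sup_left).symm hRQ)
      (hiso _ _ (Subgroup.subgroupOfEquivOfLe le_sup_right).symm hNQ) ?_
    rw [← Subgroup.subgroupOf_sup le_sup_left le_sup_right, Subgroup.subgroupOf_self]

theorem exists_normal_forall_isSubnormal_le (Q : ∀ (X : Type u) [Group X], Prop)
    (hiso : ∀ (X Y : Type u) [Group X] [Group Y], X ≃* Y → Q X → Q Y)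
    (hbot : ∀ (X : Type u) [Group X] [Subsingleton X], Q X)
    (hsup : ∀ (X : Type u) [Group X] [Finite X] (H K : Subgroup X) [H.Normal] [K.Normal],
      Q H → Q K → H ⊔ K = ⊤ → Q X)
    (G : Type u) [Group G] [Finite G] :
    ∃ R : Subgroup G, R.Normal ∧ Q R ∧ ∀ H : Subgroup G, H.IsSubnormal → Q H → H ≤ R := by
  obtain ⟨R, ⟨-, hRn, hRQ⟩, hR⟩ := exists_isGreatest_normalized Q hiso hbot hsup (⊤ : Subgroup G)
  refine ⟨R, Subgroup.normalizer_eq_top_iff.mp (top_unique hRn), hRQ, fun H hH hHQ => ?_⟩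
  suffices key : ∀ L : Subgroup G, L.IsSubnormal → ∀ N ≤ L, L ≤ Subgroup.normalizer N → Q N →
      N ≤ R from key H hH H le_rfl Subgroup.le_normalizer hHQ
  intro L hL
  induction hL with
  | top => exact fun N hle hn hQ => hR ⟨hle, hn, hQ⟩
  | step L K hLK _ hn ih =>
    intro N hNL hLN hNQ
    rw [Subgroup.normal_subgroupOf_iff_le_normalizer hLK] at hn
    obtain ⟨S, ⟨hSL, hSn, hSQ⟩, hS⟩ := exists_isGreatest_normalized Q hiso hbot hsup L
    refine (hS ⟨hNL, hLN, hNQ⟩).trans (ih S (hSL.trans hLK) ?_ hSQ)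
    intro g hg
    rw [Subgroup.mem_normalizer_iff_map_conj_eq]
    have hgL := Subgroup.mem_normalizer_iff_map_conj_eq.mp (hn hg)
    refine Subgroup.eq_of_le_of_card_ge (hS ⟨?_, ?_, ?_⟩) ?_
    · exact (Subgroup.map_mono hSL).trans hgL.le
    · exact hgL.ge.trans ((Subgroup.map_mono hSn).trans (S.le_normalizer_map _))
    · exact hiso _ _ (S.equivMapOfInjective _ (MulAut.conj g).injective) hSQ
    · exact (Nat.card_congr (S.equivMapOfInjective _ (MulAut.conj g).injective).toEquiv).le

/-- The Fitting subgroup of a finite group contains all subnormal nilpotent subgroups. -/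
theorem exists_normal_isNilpotent_forall_isSubnormal_le (G : Type u) [Group G] [Finite G] :
    ∃ F : Subgroup G, F.Normal ∧ Group.IsNilpotent F ∧
      ∀ H : Subgroup G, H.IsSubnormal → Group.IsNilpotent H → H ≤ F :=
  exists_normal_forall_isSubnormal_le (fun X _ => Group.IsNilpotent X)
    (fun _ _ _ _ e h => (Group.isNilpotent_congr e).mp h)
    (fun _ _ _ => Group.isNilpotent_of_subsingleton)
    (fun _ _ _ H K _ _ => isNilpotent_of_normal_sup_eq_top H K) G

/-- The solvable radical of a finite group contains all subnormal solvable subgroups. -/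
theorem exists_normal_isSolvable_forall_isSubnormal_le (G : Type u) [Group G] [Finite G] :
    ∃ R : Subgroup G, R.Normal ∧ Group.IsSolvable R ∧
      ∀ H : Subgroup G, H.IsSubnormal → Group.IsSolvable H → H ≤ R :=
  exists_normal_forall_isSubnormal_le (fun X _ => Group.IsSolvable X)
    (fun _ _ _ _ e _ => Group.isSolvable_of_surjective (f := e.toMonoidHom) e.surjective)
    (fun _ _ _ => inferInstance)
    (fun _ _ _ H K _ _ => isSolvable_of_normal_sup_eq_top H K) G

theorem Subgroup.isNilpotent_of_le {G : Type*} [Group G] {H K : Subgroup G} (hle : H ≤ K)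
    (hK : Group.IsNilpotent K) : Group.IsNilpotent H :=
  (Group.isNilpotent_congr (Subgroup.subgroupOfEquivOfLe hle)).mp inferInstance

theorem hasNilpotentDerivedSubgroup_iff {G : Type*} [Group G] {U : Subgroup G} :
    HasNilpotentDerivedSubgroup U ↔ Group.IsNilpotent (⁅U, U⁆ : Subgroup G) := by
  rw [← U.map_subtype_commutator]
  exact Group.isNilpotent_congr ((_root_.commutator U).equivMapOfInjective _ U.subtype_injective)

theorem HasNilpotentDerivedSubgroup.isSolvable {X : Type*} [Group X]
    (h : HasNilpotentDerivedSubgroup X) : Group.IsSolvable X := by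
  have : Group.IsNilpotent (commutator X) := h
  refine (Group.isSolvable_iff_subgroup_quotient (commutator X)).mpr ⟨inferInstance, ?_⟩
  have : IsMulCommutative (X ⧸ commutator X) :=
    Subgroup.Normal.quotient_commutative_iff_commutator_le.mpr le_rfl
  exact Group.isSolvable_of_comm fun a b => mul_comm' a b

theorem HasNilpotentDerivedSubgroup.of_isNilpotent {X : Type*} [Group X]
    [Group.IsNilpotent X] : HasNilpotentDerivedSubgroup X :=
  inferInstanceAs (Group.IsNilpotent (commutator X))

theorem HasNilpotentDerivedSubgroup.map {G : Type*} [Group G] {U : Subgroup G}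
    (h : HasNilpotentDerivedSubgroup U) {H : Type*} [Group H] (f : G →* H) :
    HasNilpotentDerivedSubgroup (U.map f) := by
  rw [hasNilpotentDerivedSubgroup_iff] at h ⊢
  rw [← Subgroup.map_commutator]
  exact Group.nilpotent_of_surjective _ (f.subgroupMap_surjective _)

theorem HasNilpotentDerivedSubgroup.exists_isMaximal_ge {G : Type*} [Group G] [Finite G]
    {A : Subgroup G} (hA : HasNilpotentDerivedSubgroup A) :
    ∃ U : Subgroup G, A ≤ U ∧ IsMaximalNilpotentDerived U := by
  obtain ⟨U, ⟨hAU, hU⟩, hmax⟩ := (wellFounded_gt (α := Subgroup G)).has_min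
    {U | A ≤ U ∧ HasNilpotentDerivedSubgroup U} ⟨A, le_rfl, hA⟩
  refine ⟨U, hAU, hU, fun V hUV hV => ?_⟩
  by_contra hne
  exact hmax V ⟨hAU.trans hUV, hV⟩ (lt_of_le_of_ne hUV hne)

theorem IsMaximalNilpotentDerived.map_equiv {G : Type*} [Group G] {U : Subgroup G}
    (h : IsMaximalNilpotentDerived U) (f : G ≃* G) :
    IsMaximalNilpotentDerived (U.map f.toMonoidHom) := by
  refine ⟨h.1.map _, fun V hUV hV => ?_⟩
  rw [h.2 (V.map f.symm.toMonoidHom) ?_ (hV.map _)]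
  · ext x
    simp [Subgroup.mem_map]
  · intro x hx
    exact ⟨f x, hUV ⟨x, hx, rfl⟩, f.symm_apply_apply x⟩

/-- The intersection of the members of a conjugation-invariant family of subgroups is normal. -/
theorem Subgroup.normal_iInf_mem_of_map_conj_mem {G : Type*} [Group G] {S : Set (Subgroup G)}
    (hS : ∀ U ∈ S, ∀ g : G, U.map (MulAut.conj g).toMonoidHom ∈ S) :
    (⨅ U ∈ S, U).Normal := by
  refine ⟨fun n hn g => ?_⟩
  simp only [Subgroup.mem_iInf] at hn ⊢
  intro U hU
  obtain ⟨u, hu, rfl⟩ := hn _ (hS U hU g⁻¹)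
  simpa [mul_assoc] using hu

theorem Subgroup.commutator_le_iff_map_le_centralizer {G : Type*} [Group G]
    {H K N : Subgroup G} [N.Normal] :
    ⁅H, K⁆ ≤ N ↔ H.map (QuotientGroup.mk' N) ≤
      Subgroup.centralizer (K.map (QuotientGroup.mk' N) : Set (G ⧸ N)) := by
  rw [← Subgroup.commutator_eq_bot_iff_le_centralizer, ← Subgroup.map_commutator,
    Subgroup.map_eq_bot_iff, QuotientGroup.ker_mk']

theorem Subgroup.commutator_sup_le {G : Type*} [Group G] {H K L N : Subgroup G} [N.Normal]
    (hH : ⁅H, L⁆ ≤ N) (hK : ⁅K, L⁆ ≤ N) : ⁅H ⊔ K, L⁆ ≤ N := by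
  rw [Subgroup.commutator_le_iff_map_le_centralizer] at *
  rw [Subgroup.map_sup]
  exact sup_le hH hK

/-- If the solvable radical `R` does not have nilpotent derived subgroup, some maximal subgroup
with nilpotent derived subgroup is not subnormal, and every subnormal subgroup containing it
contains `R`. -/
theorem exists_isMaximalNilpotentDerived_not_isSubnormal {G : Type*} [Group G] [Finite G]
    {R : Subgroup G} (hR : Group.IsSolvable R)
    (hRmax : ∀ H : Subgroup G, H.IsSubnormal → Group.IsSolvable H → H ≤ R)
    (hRnil : ¬ HasNilpotentDerivedSubgroup R) :
    ∃ M : Subgroup G, IsMaximalNilpotentDerived M ∧ ¬ M.IsSubnormal ∧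
      ∀ C : Subgroup G, C.IsSubnormal → M ≤ C → R ≤ C := by
  obtain ⟨A, hA, hAR⟩ := exists_isNilpotent_sup_commutator_eq_top R
  obtain ⟨M, hAM, hM⟩ :=
    ((HasNilpotentDerivedSubgroup.of_isNilpotent (X := A)).map R.subtype).exists_isMaximal_ge
  have key : ∀ C : Subgroup G, C.IsSubnormal → M ≤ C → R ≤ C := by
    intro C hC hMC
    rw [← Subgroup.subgroupOf_eq_top]
    refine (hC.subgroupOf (K := R)).eq_top_of_sup_commutator (top_unique (hAR.ge.trans ?_))
    exact sup_le_sup_right (Subgroup.map_le_iff_le_comap.mp (hAM.trans hMC)) _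
  refine ⟨M, hM, fun hsub => hRnil ?_, key⟩
  rw [← le_antisymm (hRmax M hsub hM.1.isSolvable) (key M hsub le_rfl)]
  exact hM.1

/-- For a finite group `G`, the intersection of all non-subnormal maximal subgroups among
subgroups with nilpotent derived subgroup equals the intersection of all maximal subgroups
among subgroups with nilpotent derived subgroup (an empty intersection being `G` itself,
i.e. `⊤`). -/
theorem intersection_nonsubnormal_maximal_nilpotentDerived
    (G : Type*) [Group G] [Finite G] :
    (⨅ U ∈ {U : Subgroup G | IsMaximalNilpotentDerived U ∧ ¬ IsSubnormalIn U}, U) =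
      ⨅ U ∈ {U : Subgroup G | IsMaximalNilpotentDerived U}, U := by
  refine le_antisymm ?_ (biInf_mono fun U hU => hU.1)
  have hDle : ∀ M : Subgroup G, IsMaximalNilpotentDerived M → ¬ M.IsSubnormal →
      (⨅ U ∈ {U : Subgroup G | IsMaximalNilpotentDerived U ∧ ¬ IsSubnormalIn U}, U) ≤ M :=
    fun M hM hsub => iInf₂_le M ⟨hM, fun h => hsub (isSubnormalIn_iff.mp h)⟩
  have hDn : (⨅ U ∈ {U : Subgroup G |
      IsMaximalNilpotentDerived U ∧ ¬ IsSubnormalIn U}, U).Normal := by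
    refine Subgroup.normal_iInf_mem_of_map_conj_mem fun U hU g =>
      ⟨hU.1.map_equiv _, fun h => hU.2 ?_⟩
    rw [isSubnormalIn_iff] at h ⊢
    have hcomap := h.comap (MulAut.conj g).toMonoidHom
    rwa [Subgroup.comap_map_eq_self_of_injective (MulAut.conj g).injective] at hcomap
  generalize (⨅ U ∈ {U : Subgroup G |
    IsMaximalNilpotentDerived U ∧ ¬ IsSubnormalIn U}, U) = D at hDle hDn ⊢
  refine le_iInf₂ fun U hU => ?_
  by_cases hsub : U.IsSubnormal
  swap
  · exact hDle U hU hsub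
  obtain ⟨R, hRn, hR, hRmax⟩ := exists_normal_isSolvable_forall_isSubnormal_le G
  have hUR := hRmax U hsub hU.1.isSolvable
  by_cases hRnil : HasNilpotentDerivedSubgroup R
  · rw [hU.2 R hUR hRnil]
    by_cases hex : ∃ M : Subgroup G, IsMaximalNilpotentDerived M ∧ ¬ M.IsSubnormal
    · obtain ⟨M, hM, hMsub⟩ := hex
      have := hM.1.isSolvable
      exact hRmax D hDn.isSubnormal (Group.isSolvable_of_isSolvable_injective
        (Subgroup.inclusion_injective (hDle M hM hMsub)))
    · push Not at hex
      intro x _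
      have : Group.IsNilpotent (Subgroup.zpowers x) :=
        @CommGroup.isNilpotent _ IsCyclic.commGroup
      obtain ⟨M, hxM, hM⟩ := (HasNilpotentDerivedSubgroup.of_isNilpotent
        (X := Subgroup.zpowers x)).exists_isMaximal_ge
      exact hRmax M (hex M hM) hM.1.isSolvable (hxM (Subgroup.mem_zpowers x))
  obtain ⟨M, hM, hMsub, hMR⟩ :=
    exists_isMaximalNilpotentDerived_not_isSubnormal hR hRmax hRnil
  obtain ⟨F, hFn, hF, hFmax⟩ := exists_normal_isNilpotent_forall_isSubnormal_le G
  have hDM := hDle M hM hMsub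
  have hM' := hasNilpotentDerivedSubgroup_iff.mp hM.1
  have hU' := hasNilpotentDerivedSubgroup_iff.mp hU.1
  have hMD : ⁅M, D⁆ ≤ F := by
    have hle : ⁅M, D⁆ ≤ ⁅M, M⁆ := Subgroup.commutator_mono le_rfl hDM
    have hleD : ⁅M, D⁆ ≤ D := Subgroup.commutator_le_right M D
    refine hFmax _ (.step _ D hleD hDn.isSubnormal ?_) (Subgroup.isNilpotent_of_le hle hM')
    rw [Subgroup.normal_subgroupOf_iff_le_normalizer hleD]
    exact Subgroup.normalizer_commutator_ge_right M D
  have hUD : ⁅U, D⁆ ≤ F := by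
    rw [Subgroup.commutator_le_iff_map_le_centralizer, Subgroup.map_le_iff_le_comap] at hMD ⊢
    have : (D.map (QuotientGroup.mk' F)).Normal := hDn.map _ (QuotientGroup.mk'_surjective F)
    exact hUR.trans (hMR _ (Subgroup.Normal.isSubnormal inferInstance) hMD)
  have hDD : ⁅D, D⁆ ≤ F := (Subgroup.commutator_mono hDM le_rfl).trans hMD
  have hUU : ⁅U, U⁆ ≤ F := by
    refine hFmax _ (.step _ U U.commutator_le_self hsub ?_) hU'
    rw [Subgroup.normal_subgroupOf_iff_le_normalizer U.commutator_le_self]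
    exact Subgroup.normalizer_commutator_ge_right U U
  have hsup : ⁅U ⊔ D, U ⊔ D⁆ ≤ F := by
    refine Subgroup.commutator_sup_le ?_ ?_
    · rw [Subgroup.commutator_comm]
      exact Subgroup.commutator_sup_le hUU (Subgroup.commutator_comm U D ▸ hUD)
    · rw [Subgroup.commutator_comm]
      exact Subgroup.commutator_sup_le hUD hDD
  rw [hU.2 (U ⊔ D) le_sup_left
    (hasNilpotentDerivedSubgroup_iff.mpr (Subgroup.isNilpotent_of_le hsup hF))]
  exact le_sup_right
end
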